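/- Let (T₁,T₂,T₃) be an anti-commuting triple of invertible contractions on ℂ². Then there exist a complex Hilbert space K, unitary operators U₁,U₂,U₃ on K with U_iU_j = −U_jU_i for all 1 ≤ i < j ≤ 3, a non-zero scalar β ∈ ℂ, and a linear isometry V : ℂ² → K such that T₁^{m}T₂^{n}T₃^{r} = β^{m} · V* U₁^{m}U₂^{n}U₃^{r} V for all nonnegative integers m, n, r (i.e. the triple (βU₁, U₂, U₃) dilates (T₁,T₂,T₃)). -/

import Mathlib

/-- The operator norm of a `2 × 2` complex matrix regarded as an operator on the
Hilbert space `ℂ²` (i.e. `EuclideanSpace ℂ (Fin 2)`, with the `ℓ²` norm). -/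
noncomputable def opNorm2 (T : Matrix (Fin 2) (Fin 2) ℂ) : ℝ :=
  ‖Matrix.toEuclideanCLM (𝕜 := ℂ) T‖

open scoped InnerProductSpace ComplexOrder ComplexConjugate

abbrev E2 := EuclideanSpace ℂ (Fin 2)

noncomputable def avgState (e : E2) : C(Circle, E2 →L[ℂ] E2) →ₗ[ℂ] ℂ where
  toFun h := (2 * Real.pi : ℂ)⁻¹ * ∫ θ in (0:ℝ)..(2 * Real.pi), ⟪e, h (Circle.exp θ) e⟫_ℂ
  map_add' g h := by
    rw [← mul_add, ← intervalIntegral.integral_add]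
    · simp
    · apply Continuous.intervalIntegrable; fun_prop
    · apply Continuous.intervalIntegrable; fun_prop
  map_smul' c h := by
    simp only [ContinuousMap.coe_smul, Pi.smul_apply, smul_apply,
      inner_smul_right, intervalIntegral.integral_const_mul, RingHom.id_apply, smul_eq_mul]
    ring

lemma avgState_nonneg (e : E2) (h : C(Circle, E2 →L[ℂ] E2)) :
    0 ≤ avgState e (star h * h) := by
  have : avgState e (star h * h) = (((2 * Real.pi)⁻¹ *
      ∫ θ in (0:ℝ)..(2 * Real.pi), ‖h (Circle.exp θ) e‖ ^ 2 : ℝ) : ℂ) := by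
    simp only [avgState, LinearMap.coe_mk, AddHom.coe_mk]
    push_cast
    congr 1
    rw [← intervalIntegral.integral_ofReal]
    congr 1
    ext θ
    change ⟪e, (ContinuousLinearMap.adjoint (h (Circle.exp θ))) ((h (Circle.exp θ)) e)⟫_ℂ = _
    rw [ContinuousLinearMap.adjoint_inner_right, inner_self_eq_norm_sq_to_K]
    simp
  rw [this]
  have h2 : 0 ≤ ∫ θ in (0:ℝ)..(2 * Real.pi), ‖h (Circle.exp θ) e‖ ^ 2 := by
    apply intervalIntegral.integral_nonneg (by positivity)
    intros; positivity
  exact_mod_cast mul_nonneg (by positivity) h2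

lemma gns_abs (A : Type) [CStarAlgebra A] (φ : A →ₗ[ℂ] ℂ) (hφ : ∀ a, 0 ≤ φ (star a * a)) :
    ∃ (K : Type) (_ : NormedAddCommGroup K) (_ : InnerProductSpace ℂ K)
    (_ : CompleteSpace K) (π : A → (K →L[ℂ] K)) (ι : A →ₗ[ℂ] K),
    (π 1 = 1 ∧ (∀ a b, π (a * b) = π a * π b) ∧ (∀ a, π (star a) = star (π a)) ∧
      (∀ a, π (-a) = -π a) ∧ ∀ a (k : ℕ), π (a ^ k) = π a ^ k) ∧
    ∀ F a b, ⟪ι a, π F (ι b)⟫_ℂ = φ (star a * (F * b)) := by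
  let _ := CStarAlgebra.spectralOrder A
  have _ := CStarAlgebra.spectralOrderedRing A
  let f : A →ₚ[ℂ] ℂ := PositiveLinearMap.mk₀ φ (by
    intro x hx
    obtain ⟨s, rfl⟩ := CStarAlgebra.nonneg_iff_eq_star_mul_self.1 hx
    exact hφ s)
  have hf : ∀ a, f a = φ a := fun a => rfl
  let V0 : A →ₗ[ℂ] f.GNS :=
    { toFun := fun x => ((f.toPreGNS x : f.PreGNS) : f.GNS)
      map_add' := fun x y => by
        rw [← UniformSpace.Completion.coe_add, ← map_add]
      map_smul' := fun a x => by
        rw [RingHom.id_apply, ← UniformSpace.Completion.coe_smul, ← map_smul] }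
  refine ⟨f.GNS, inferInstance, inferInstance, inferInstance, f.gnsStarAlgHom, V0,
    ⟨map_one _, map_mul _, map_star _, map_neg _, map_pow _⟩, ?_⟩
  intro F x y
  have : f.gnsStarAlgHom F (V0 y) = ((f.toPreGNS (F * y) : f.PreGNS) : f.GNS) := by
    simp [V0]
  rw [this]
  change ⟪((f.toPreGNS x : f.PreGNS) : f.GNS), _⟫_ℂ = _
  rw [UniformSpace.Completion.inner_coe, PositiveLinearMap.preGNS_inner_def]
  rfl

lemma gns_part : ∃ (K : Type) (_ : NormedAddCommGroup K) (_ : InnerProductSpace ℂ K)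
    (_ : CompleteSpace K) (π : C(Circle, E2 →L[ℂ] E2) → (K →L[ℂ] K)) (V : E2 →ₗᵢ[ℂ] K),
    (π 1 = 1 ∧ (∀ a b, π (a * b) = π a * π b) ∧ (∀ a, π (star a) = star (π a)) ∧
      (∀ a, π (-a) = -π a) ∧ ∀ a (k : ℕ), π (a ^ k) = π a ^ k) ∧
    ∀ F x y, ⟪V y, π F (V x)⟫_ℂ = (2 * Real.pi : ℂ)⁻¹ *
      ∫ θ in (0:ℝ)..(2 * Real.pi), ⟪y, F (Circle.exp θ) x⟫_ℂ := by
  let e : E2 := EuclideanSpace.single 0 1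
  have he : ⟪e, e⟫_ℂ = 1 := by simp [e]
  obtain ⟨K, i1, i2, i3, π, ι, hπ, hι⟩ := gns_abs C(Circle, E2 →L[ℂ] E2)
    (avgState e) (avgState_nonneg e)
  let c : E2 →ₗ[ℂ] C(Circle, E2 →L[ℂ] E2) :=
    { toFun := fun x => ContinuousMap.const _ (InnerProductSpace.rankOne ℂ x e)
      map_add' := fun x y => by ext1 z; simp
      map_smul' := fun a x => by ext1 z; simp }
  have key2 : ∀ F x y, ⟪ι (c y), π F (ι (c x))⟫_ℂ = (2 * Real.pi : ℂ)⁻¹ *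
      ∫ θ in (0:ℝ)..(2 * Real.pi), ⟪y, F (Circle.exp θ) x⟫_ℂ := by
    intro F x y
    rw [hι]
    simp only [avgState, LinearMap.coe_mk, AddHom.coe_mk]
    congr 1
    congr 1
    ext θ
    change ⟪e, (ContinuousLinearMap.adjoint (InnerProductSpace.rankOne ℂ y e))
      ((F (Circle.exp θ)) (InnerProductSpace.rankOne ℂ x e e))⟫_ℂ = _
    rw [ContinuousLinearMap.adjoint_inner_right]
    simp only [InnerProductSpace.rankOne_apply, he, one_smul]
  have hV : ∀ x, ‖ι (c x)‖ = ‖x‖ := by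
    intro x
    have := key2 1 x x
    rw [hπ.1] at this
    simp only [one_apply_eq_self, ContinuousMap.one_apply] at this
    rw [inner_self_eq_norm_sq_to_K, inner_self_eq_norm_sq_to_K, intervalIntegral.integral_const,
      sub_zero, Complex.real_smul] at this
    have hpi : (Real.pi : ℂ) ≠ 0 := by exact_mod_cast Real.pi_ne_zero
    push_cast at this
    rw [inv_mul_cancel_left₀ (by simp)] at this
    have h3 : ‖ι (c x)‖ ^ 2 = ‖x‖ ^ 2 := by exact_mod_cast this
    exact (sq_eq_sq₀ (norm_nonneg _) (norm_nonneg _)).1 h3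
  exact ⟨K, i1, i2, i3, π, ⟨ι ∘ₗ c, hV⟩, hπ, key2⟩

/-- Dilation lemma: evaluation at zero. -/
lemma dil_part : ∃ (K : Type) (_ : NormedAddCommGroup K) (_ : InnerProductSpace ℂ K)
    (_ : CompleteSpace K) (π : C(Circle, E2 →L[ℂ] E2) → (K →L[ℂ] K)) (V : E2 →ₗᵢ[ℂ] K),
    (π 1 = 1 ∧ (∀ a b, π (a * b) = π a * π b) ∧ (∀ a, π (star a) = star (π a)) ∧
      (∀ a, π (-a) = -π a) ∧ ∀ a (k : ℕ), π (a ^ k) = π a ^ k) ∧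
    ∀ (F : C(Circle, E2 →L[ℂ] E2)) (G : ℂ → (E2 →L[ℂ] E2)),
      (∀ z, ‖z‖ ≤ 1 → DifferentiableAt ℂ G z) → (∀ z : Circle, F z = G z) →
      (ContinuousLinearMap.adjoint V.toContinuousLinearMap) ∘L (π F) ∘L V.toContinuousLinearMap
        = G 0 := by
  obtain ⟨K, i1, i2, i3, π, V, hπ, h⟩ := gns_part
  refine ⟨K, i1, i2, i3, π, V, hπ, ?_⟩
  intro F G hG hFG
  ext1 x
  refine ext_inner_left ℂ fun y => ?_
  rw [ContinuousLinearMap.comp_apply, ContinuousLinearMap.adjoint_inner_right]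
  refine (h F x y).trans ?_
  have hd : ∀ z, ‖z‖ ≤ 1 → DifferentiableAt ℂ (fun z => ⟪y, G z x⟫_ℂ) z := by
    intro z hz
    exact ((innerSL ℂ y).differentiableAt).comp z ((hG z hz).clm_apply (differentiableAt_const x))
  have hD : DiffContOnCl ℂ (fun z => ⟪y, G z x⟫_ℂ) (Metric.ball 0 |1|) := by
    refine DifferentiableOn.diffContOnCl fun z hz => (hd z ?_).differentiableWithinAt
    have := Metric.closure_ball_subset_closedBall hz
    simpa using this
  have := hD.circleAverage
  rw [← this, Real.circleAverage, Complex.real_smul]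
  push_cast
  congr 2
  ext θ
  rw [hFG]
  simp [circleMap, Circle.coe_exp]

abbrev M2 := Matrix (Fin 2) (Fin 2) ℂ

/-- A matrix function with entries differentiable on the closed unit disc. -/
def An (u : ℂ → M2) : Prop := ∀ z, ‖z‖ ≤ 1 → ∀ i j, DifferentiableAt ℂ (fun z => u z i j) z

/-- The pair has an inner anticommuting extension. -/
def Good (A B : M2) : Prop := ∃ u w : ℂ → M2, An u ∧ An w ∧
  (∀ z, ‖z‖ = 1 → u z ∈ unitary M2 ∧ w z ∈ unitary M2 ∧ u z * w z = -(w z * u z)) ∧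
  u 0 = A ∧ w 0 = B

lemma An.clm {u : ℂ → M2} (hu : An u) (z : ℂ) (hz : ‖z‖ ≤ 1) :
    DifferentiableAt ℂ (fun z => Matrix.toEuclideanCLM (𝕜 := ℂ) (u z)) z := by
  have : (fun z => Matrix.toEuclideanCLM (𝕜 := ℂ) (u z)) = fun z => ∑ i, ∑ j,
      u z i j • Matrix.toEuclideanCLM (𝕜 := ℂ) (Matrix.single i j (1:ℂ)) := by
    ext1 z
    conv_lhs => rw [Matrix.matrix_eq_sum_single (u z)]
    simp only [map_sum, ← map_smul]
    simp
  rw [this]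
  refine DifferentiableAt.fun_sum fun i _ => DifferentiableAt.fun_sum fun j _ => ?_
  exact (hu z hz i j).smul_const _

lemma good_dil {T₁ A B : M2} (β : ℂ) (hβ : β ≠ 0) (hT : T₁ = β • (A * B)) (hg : Good A B) :
    ∃ (K : Type) (_ : NormedAddCommGroup K) (_ : InnerProductSpace ℂ K) (_ : CompleteSpace K)
      (U₁ U₂ U₃ : K →L[ℂ] K) (β : ℂ) (V : EuclideanSpace ℂ (Fin 2) →ₗᵢ[ℂ] K),
      U₁ ∈ unitary (K →L[ℂ] K) ∧ U₂ ∈ unitary (K →L[ℂ] K) ∧ U₃ ∈ unitary (K →L[ℂ] K) ∧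
      U₁ * U₂ = -(U₂ * U₁) ∧ U₁ * U₃ = -(U₃ * U₁) ∧ U₂ * U₃ = -(U₃ * U₂) ∧
      β ≠ 0 ∧
      (∀ m n r : ℕ,
        Matrix.toEuclideanCLM (𝕜 := ℂ) (T₁ ^ m * A ^ n * B ^ r) =
          β ^ m • ((ContinuousLinearMap.adjoint V.toContinuousLinearMap) ∘L
            (U₁ ^ m * U₂ ^ n * U₃ ^ r) ∘L V.toContinuousLinearMap)) := by
  obtain ⟨u, w, hu, hw, huw, hu0, hw0⟩ := hg
  obtain ⟨K, i1, i2, i3, π, V, ⟨hone, hmul, hstar, hneg, hpow⟩, h⟩ := dil_part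
  let L : M2 → (E2 →L[ℂ] E2) := fun M => Matrix.toEuclideanCLM (𝕜 := ℂ) M
  have hc : ∀ {u : ℂ → M2}, An u → Continuous (fun z : Circle => L (u z)) := by
    intro u hu
    refine continuous_iff_continuousAt.2 fun z => ?_
    exact ContinuousAt.comp (f := fun z : Circle => (z : ℂ)) (hu.clm z (Circle.norm_coe z).le).continuousAt
      continuous_subtype_val.continuousAt
  have hz : ∀ z : Circle, ‖(z : ℂ)‖ = 1 := fun z => Circle.norm_coe z
  let FU : C(Circle, E2 →L[ℂ] E2) := ⟨_, hc hu⟩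
  let FW : C(Circle, E2 →L[ℂ] E2) := ⟨_, hc hw⟩
  have hL : ∀ {M : M2}, M ∈ unitary M2 → star (L M) * L M = 1 ∧ L M * star (L M) = 1 := by
    intro M hM
    have h1 : star (L M) = L (star M) := (map_star (Matrix.toEuclideanCLM (𝕜 := ℂ)) M).symm
    have h2 : ∀ X Y : M2, L X * L Y = L (X * Y) := fun X Y =>
      (map_mul (Matrix.toEuclideanCLM (𝕜 := ℂ)) X Y).symm
    rw [h1, h2, h2, (Unitary.mem_iff.1 hM).1, (Unitary.mem_iff.1 hM).2]
    exact ⟨map_one _, map_one _⟩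
  have huU : π FU ∈ unitary (K →L[ℂ] K) := by
    refine Unitary.mem_iff.2 ⟨?_, ?_⟩
    · rw [← hstar, ← hmul, ← hone]
      congr 1
      ext1 z
      exact (hL (huw z (hz z)).1).1
    · rw [← hstar, ← hmul, ← hone]
      congr 1
      ext1 z
      exact (hL (huw z (hz z)).1).2
  have huW : π FW ∈ unitary (K →L[ℂ] K) := by
    refine Unitary.mem_iff.2 ⟨?_, ?_⟩
    · rw [← hstar, ← hmul, ← hone]
      congr 1
      ext1 z
      exact (hL (huw z (hz z)).2.1).1
    · rw [← hstar, ← hmul, ← hone]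
      congr 1
      ext1 z
      exact (hL (huw z (hz z)).2.1).2
  have hanti : π FU * π FW = -(π FW * π FU) := by
    rw [← hmul, ← hmul, ← hneg]
    congr 1
    ext1 z
    have := congrArg L (huw z (hz z)).2.2
    have e1 : L (u z * w z) = L (u z) * L (w z) := map_mul (Matrix.toEuclideanCLM (𝕜 := ℂ)) _ _
    have e2 : L (-(w z * u z)) = -(L (w z) * L (u z)) :=
      (map_neg (Matrix.toEuclideanCLM (𝕜 := ℂ)) _).trans
        (congrArg _ (map_mul (Matrix.toEuclideanCLM (𝕜 := ℂ)) _ _))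
    rw [e1, e2] at this
    exact this
  refine ⟨K, i1, i2, i3, π FU * π FW, π FU, π FW, β, V, mul_mem huU huW, huU, huW, ?_, ?_, hanti,
    hβ, ?_⟩
  · rw [mul_assoc, ← neg_eq_iff_eq_neg.2 hanti, mul_neg]
  · rw [← mul_assoc, ← neg_eq_iff_eq_neg.2 hanti, neg_mul, neg_neg]
  · intro m n r
    have h1 := h ((FU * FW) ^ m * FU ^ n * FW ^ r)
      (fun z => (L (u z) * L (w z)) ^ m * L (u z) ^ n * L (w z) ^ r) (fun z hz => by
        have a1 : DifferentiableAt ℂ (fun z => L (u z)) z := hu.clm z hz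
        have a2 : DifferentiableAt ℂ (fun z => L (w z)) z := hw.clm z hz
        exact (((a1.mul a2).pow m).mul (a1.pow n)).mul (a2.pow r)) (fun z => by
        simp only [ContinuousMap.mul_apply, ContinuousMap.pow_apply]; rfl)
    have h2 : π ((FU * FW) ^ m * FU ^ n * FW ^ r) = (π FU * π FW) ^ m * π FU ^ n * π FW ^ r := by
      rw [hmul, hmul, hpow, hpow, hpow, hmul]
    rw [h2] at h1
    rw [h1, hT, hu0, hw0]
    simp only [L, ← map_mul, ← map_pow, ← map_smul]
    congr 1
    rw [smul_pow, smul_mul_assoc, smul_mul_assoc]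

/-- A scalar function differentiable on the closed unit disc. -/
def An1 (m : ℂ → ℂ) : Prop := ∀ z, ‖z‖ ≤ 1 → DifferentiableAt ℂ m z

lemma norm_one_iff (z : ℂ) : ‖z‖ = 1 ↔ z * conj z = 1 := by
  rw [Complex.mul_conj, Complex.normSq_eq_norm_sq]
  norm_cast
  rw [pow_eq_one_iff_of_nonneg (norm_nonneg _) (by norm_num)]

lemma blaschke (a : ℂ) (ha : ‖a‖ ≤ 1) : ∃ m : ℂ → ℂ, An1 m ∧
    (∀ z, ‖z‖ = 1 → m z * conj (m z) = 1) ∧ (∀ z, ‖z‖ ≤ 1 → ‖m z‖ ≤ 1) ∧ m 0 = a := by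
  rcases eq_or_lt_of_le ha with h | h
  · exact ⟨fun _ => a, fun z _ => differentiableAt_const _, fun _ _ => (norm_one_iff a).1 h,
      fun _ _ => ha, rfl⟩
  · have hne : ∀ z : ℂ, ‖z‖ ≤ 1 → 1 + conj a * z ≠ 0 := by
      intro z hz h0
      have : ‖conj a * z‖ = 1 := by
        rw [← neg_eq_iff_add_eq_zero.2 h0]; simp
      rw [norm_mul, Complex.norm_conj] at this
      nlinarith [norm_nonneg a, norm_nonneg z]
    refine ⟨fun z => (z + a) / (1 + conj a * z), fun z hz => ?_, fun z hz => ?_, fun z hz => ?_, ?_⟩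
    · have := hne z hz
      fun_prop (disch := assumption)
    · have h1 := hne z hz.le
      have h2 : 1 + a * conj z ≠ 0 := by
        intro h; apply h1; have := congrArg conj h; simpa using this
      rw [norm_one_iff] at hz
      simp only [map_div₀, map_add, map_mul, map_one, Complex.conj_conj]
      rw [div_mul_div_comm, div_eq_one_iff_eq (mul_ne_zero h1 h2)]
      linear_combination (1 - a * conj a) * hz
    · rw [norm_div, div_le_one (norm_pos_iff.2 (hne z hz))]
      refine le_of_sq_le_sq ?_ (norm_nonneg _) 
      have e : ‖1 + conj a * z‖ ^ 2 - ‖z + a‖ ^ 2 = (1 - ‖a‖ ^ 2) * (1 - ‖z‖ ^ 2) := by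
        apply Complex.ofReal_injective
        push_cast
        simp only [← Complex.mul_conj', map_add, map_mul, map_one, Complex.conj_conj]
        ring
      have h3 : 0 ≤ (1 - ‖a‖ ^ 2) * (1 - ‖z‖ ^ 2) := by
        apply mul_nonneg <;> nlinarith [norm_nonneg a, norm_nonneg z]
      linarith
    · simp

lemma quad_exists (d : ℝ) : ∃ k : ℝ, 0 < k ∧ k ≤ 1 ∧ k = 1 - k ^ 2 * d ^ 2 := by
  have hs := Real.sq_sqrt (show 0 ≤ 1 + 4 * d ^ 2 by positivity)
  have h0 := Real.sqrt_nonneg (1 + 4 * d ^ 2)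
  set s := Real.sqrt (1 + 4 * d ^ 2)
  have h1 : 1 ≤ s := by nlinarith [sq_nonneg d]
  refine ⟨2 / (1 + s), by positivity, ?_, ?_⟩
  · rw [div_le_one (by positivity)]; linarith
  · field_simp
    nlinarith

lemma alpha_exists (κ q : ℂ) (hκ : ‖κ‖ < 1) :
    ∃ α : ℂ, ‖α‖ < 1 ∧ conj α * κ - α = q * (1 - α * conj α) := by
  set d : ℂ := (q + κ * conj q) / (1 - κ * conj κ) with hd
  obtain ⟨k, hk0, hk1, hk⟩ := quad_exists ‖d‖
  have hN : (1 - κ * conj κ : ℂ) ≠ 0 := by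
    rw [Complex.mul_conj']
    norm_cast
    nlinarith [norm_nonneg κ]
  have hα : ((1 - -(k * d) * conj (-(k * d)) : ℂ)) = k := by
    rw [Complex.mul_conj', norm_neg, norm_mul, Complex.norm_real, Real.norm_eq_abs]
    norm_cast
    rw [mul_pow, sq_abs]
    exact hk.symm
  refine ⟨-(k * d), ?_, ?_⟩
  · have : ‖-(k * d : ℂ)‖ ^ 2 = 1 - k := by
      rw [norm_neg, norm_mul, Complex.norm_real, Real.norm_eq_abs, mul_pow, sq_abs]; linarith
    nlinarith [norm_nonneg (-(k * d : ℂ))]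
  · rw [hα, hd]
    have hN' : (1 - conj κ * κ : ℂ) ≠ 0 := by rwa [mul_comm]
    simp only [map_neg, map_mul, map_div₀, map_sub, map_one, map_add, Complex.conj_conj,
      Complex.conj_ofReal]
    field_simp
    ring

lemma xy_exists (κ p t : ℂ) (hκ : ‖κ‖ ≤ 1)
    (hC : ∀ v0 v1 : ℂ, ‖p * v0 - t * v1‖ ^ 2 + ‖-κ * t * v0 + p * v1‖ ^ 2 ≤
      ‖v0‖ ^ 2 + ‖v1‖ ^ 2) :
    ∃ ψ x y : ℂ → ℂ, An1 ψ ∧ An1 x ∧ An1 y ∧ ψ 0 = κ ∧ x 0 = p ∧ y 0 = -t ∧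
      ∀ z, ‖z‖ = 1 → ψ z * conj (ψ z) = 1 ∧ x z * conj (x z) + y z * conj (y z) = 1 ∧
        conj (x z) * y z + x z * conj (y z) * conj (ψ z) = 0 := by
  have hp : ‖p‖ ≤ 1 := by
    have := hC 1 0
    simp at this
    nlinarith [norm_nonneg p, sq_nonneg (‖κ‖ * ‖t‖)]
  obtain ⟨ψ, hψ1, hψ2, hψ3, hψ4⟩ := blaschke κ hκ
  by_cases ht : t = 0
  · obtain ⟨m, hm1, hm2, hm3, hm4⟩ := blaschke p hp
    refine ⟨ψ, m, fun _ => 0, hψ1, hm1, fun z _ => differentiableAt_const _, hψ4, hm4, by simp [ht],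
      fun z hz => ⟨hψ2 z hz, by simp [hm2 z hz], by simp⟩⟩
  rcases eq_or_lt_of_le hκ with h | h
  · obtain ⟨s, hs'⟩ := IsAlgClosed.exists_pow_nat_eq κ (n := 2) (by norm_num)
    have hs : κ = s ^ 2 := hs'.symm
    have hs1 : ‖s‖ = 1 := by
      rw [hs, norm_pow] at h
      exact (pow_eq_one_iff_of_nonneg (norm_nonneg _) (by norm_num)).1 h
    have hsc := (norm_one_iff s).1 hs1
    have hs0 : s ≠ 0 := by rintro rfl; simp at hs1
    have hb : ∀ s : ℂ, κ = s ^ 2 → ‖s‖ = 1 → ‖p - t * s‖ ≤ 1 := by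
      intro s hs hs1
      have := hC 1 s
      have e : -κ * t * 1 + p * s = (p - t * s) * s := by rw [hs]; ring
      rw [e, norm_mul, hs1] at this
      simp at this
      nlinarith [norm_nonneg (p - t * s)]
    have hb2 := hb (-s) (by rw [hs]; ring) (by simpa using hs1)
    obtain ⟨m, hm1, hm2, hm3, hm4⟩ := blaschke (p - t * s) (hb s hs hs1)
    obtain ⟨n, hn1, hn2, hn3, hn4⟩ := blaschke (p - t * -s) hb2
    refine ⟨fun _ => κ, fun z => (m z + n z) / 2, fun z => (m z - n z) * conj s / 2,
      fun z _ => differentiableAt_const _, fun z hz => ?_, fun z hz => ?_, rfl, ?_, ?_, ?_⟩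
    · have := hm1 z hz; have := hn1 z hz; fun_prop
    · have := hm1 z hz; have := hn1 z hz; fun_prop
    · simp only [hm4, hn4]; ring
    · simp only [hm4, hn4]; linear_combination -t * hsc
    · intro z hz
      have h1 := hm2 z hz
      have h2 := hn2 z hz
      refine ⟨(norm_one_iff κ).1 h, ?_, ?_⟩
      · simp only [map_div₀, map_add, map_sub, map_mul, Complex.conj_conj, map_ofNat]
        linear_combination (m z - n z) * (conj (m z) - conj (n z)) / 4 * hsc + h1 / 2 + h2 / 2
      · simp only [map_div₀, map_add, map_sub, map_mul, Complex.conj_conj, map_ofNat, hs, map_pow]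
        linear_combination (m z + n z) * (conj (m z) - conj (n z)) / 4 * conj s * hsc
          + conj s * h1 / 2 - conj s * h2 / 2
  · obtain ⟨α, hα, hα2⟩ := alpha_exists κ (-p / t) h
    have hk : (1 - α * conj α : ℂ) ≠ 0 := by
      rw [Complex.mul_conj']
      norm_cast
      nlinarith [norm_nonneg α]
    have hden : ∀ c : ℂ, ‖c‖ ≤ 1 → 1 - conj α ^ 2 * c ≠ 0 := by
      intro c hc h0
      have : ‖conj α ^ 2 * c‖ = 1 := by rw [← sub_eq_zero.1 h0]; simp
      rw [norm_mul, norm_pow, Complex.norm_conj] at this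
      have h4 : ‖α‖ ^ 2 < 1 := by nlinarith [norm_nonneg α]
      nlinarith [norm_nonneg c, sq_nonneg ‖α‖]
    have hα3 : (conj α * κ - α) * t = -p * (1 - α * conj α) := by
      rw [hα2]; field_simp
    set γ : ℂ := -t * (1 - conj α ^ 2 * κ) / (1 - α * conj α) with hγ
    have hγ1 : γ * (1 - α * conj α) = -t * (1 - conj α ^ 2 * κ) := by
      rw [hγ, div_mul_cancel₀ _ hk]
    have hγn : ‖γ‖ ≤ 1 := by
      have := hC (-conj α) 1
      have e1 : p * -conj α - t * 1 = γ := by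
        apply mul_right_cancel₀ hk
        rw [hγ1]
        linear_combination -conj α * hα3
      have e2 : -κ * t * (-conj α) + p * 1 = -α * γ := by
        apply mul_right_cancel₀ hk
        linear_combination α * hγ1 + hα3
      rw [e1, e2] at this
      simp only [norm_mul, norm_neg, Complex.norm_conj, norm_one] at this
      have h5 : ‖γ‖ ^ 2 * (1 + ‖α‖ ^ 2) ≤ 1 * (1 + ‖α‖ ^ 2) := by nlinarith
      have h6 := le_of_mul_le_mul_right h5 (by positivity)
      nlinarith [norm_nonneg γ]
    obtain ⟨m, hm1, hm2, hm3, hm4⟩ := blaschke γ hγn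
    refine ⟨ψ, fun z => m z * (conj α * ψ z - α) / (1 - conj α ^ 2 * ψ z),
      fun z => m z * (1 - α * conj α) / (1 - conj α ^ 2 * ψ z), hψ1, fun z hz => ?_, fun z hz => ?_,
      hψ4, ?_, ?_, ?_⟩
    · have := hm1 z hz; have := hψ1 z hz; have := hden _ (hψ3 z hz)
      fun_prop (disch := assumption)
    · have := hm1 z hz; have := hψ1 z hz; have := hden _ (hψ3 z hz)
      fun_prop (disch := assumption)
    · simp only [hm4, hψ4]
      rw [div_eq_iff (hden κ hκ)]
      apply mul_right_cancel₀ hk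
      linear_combination (conj α * κ - α) * hγ1 - (1 - conj α ^ 2 * κ) * hα3
    · simp only [hm4, hψ4]
      rw [div_eq_iff (hden κ hκ)]
      exact hγ1
    · intro z hz
      have h1 := hψ2 z hz
      have h2 := hm2 z hz
      have h3 := hden _ (hψ3 z hz.le)
      have h4 : 1 - α ^ 2 * conj (ψ z) ≠ 0 := by
        intro h; apply h3; have := congrArg conj h; simpa using this
      refine ⟨h1, ?_, ?_⟩
      · simp only [map_div₀, map_mul, map_sub, map_one, map_pow, Complex.conj_conj]
        field_simp
        generalize conj (ψ z) = ψ' at *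
        generalize conj (m z) = m' at *
        generalize conj α = α' at *
        linear_combination (α * α' * m z * m' - α ^ 2 * α' ^ 2) * h1 +
          (α' * α + (1 - α * α') ^ 2 + α * α' - α' ^ 2 * ψ z - α ^ 2 * ψ') * h2
      · simp only [map_div₀, map_mul, map_sub, map_one, map_pow, Complex.conj_conj]
        field_simp
        generalize conj (ψ z) = ψ' at *
        generalize conj (m z) = m' at *
        generalize conj α = α' at *
        linear_combination (α' * m z * m' * (1 - α * α')) * h1

lemma core_good (a κ p t : ℂ) (ha : ‖a‖ ≤ 1) (hκ : ‖κ‖ ≤ 1)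
    (hC : ∀ v0 v1 : ℂ, ‖p * v0 - t * v1‖ ^ 2 + ‖-κ * t * v0 + p * v1‖ ^ 2 ≤
      ‖v0‖ ^ 2 + ‖v1‖ ^ 2) :
    Good !![0, a; a * κ, 0] !![p, t; -κ * t, -p] := by
  obtain ⟨ψ, x, y, hψ, hx, hy, hψ0, hx0, hy0, h⟩ := xy_exists κ p t hκ hC
  obtain ⟨m, hm1, hm2, -, hm4⟩ := blaschke a ha
  refine ⟨fun z => !![0, m z; m z * ψ z, 0], fun z => !![x z, -y z; ψ z * y z, -x z], ?_, ?_, ?_,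
    ?_, ?_⟩
  · intro z hz i j
    have := hm1 z hz
    have := hψ z hz
    fin_cases i <;> fin_cases j <;> simp <;> fun_prop
  · intro z hz i j
    have := hx z hz
    have := hy z hz
    have := hψ z hz
    fin_cases i <;> fin_cases j <;> simp <;> fun_prop
  · intro z hz
    obtain ⟨h1, h2, h3⟩ := h z hz
    have h4 := hm2 z hz
    have h3' : x z * conj (y z) + conj (x z) * y z * ψ z = 0 := by
      have := congrArg conj h3
      simpa using this
    refine ⟨?_, ?_, ?_⟩
    · change _ ∈ Matrix.unitaryGroup (Fin 2) ℂ
      rw [Matrix.mem_unitaryGroup_iff]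
      ext i j
      fin_cases i <;> fin_cases j <;> simp [Matrix.mul_apply, Matrix.star_apply]
      · exact h4
      · linear_combination ψ z * conj (ψ z) * h4 + h1
    · change _ ∈ Matrix.unitaryGroup (Fin 2) ℂ
      rw [Matrix.mem_unitaryGroup_iff]
      ext i j
      fin_cases i <;> fin_cases j <;> simp [Matrix.mul_apply, Matrix.star_apply]
      · exact h2
      · linear_combination h3
      · linear_combination h3'
      · linear_combination y z * conj (y z) * h1 + h2
    · ext i j
      fin_cases i <;> fin_cases j <;> simp [Matrix.mul_apply] <;> ring
  · simp [hm4, hψ0]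
  · simp [hx0, hy0, hψ0]

lemma phase_exists (d : ℂ) : ∃ ω : ℂ, ω * conj ω = 1 ∧ conj (d * ω) = d * ω := by
  by_cases hd : d = 0
  · exact ⟨1, by simp, by simp [hd]⟩
  · have hn : (‖d‖ : ℂ) ≠ 0 := by simpa using hd
    have hdd : d * conj d = (‖d‖ : ℂ) ^ 2 := Complex.mul_conj' d
    refine ⟨conj d / ‖d‖, ?_, ?_⟩
    · simp only [map_div₀, Complex.conj_conj, Complex.conj_ofReal]
      rw [div_mul_div_comm, div_eq_one_iff_eq (mul_ne_zero hn hn)]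
      linear_combination hdd
    · simp only [map_mul, map_div₀, Complex.conj_conj, Complex.conj_ofReal]
      ring

lemma y_exists (p q r : ℂ) : ∃ y : ℂ, p + q * y + r * conj y - p * (y * conj y) = 0 := by
  by_cases hp : p = 0
  · exact ⟨0, by simp [hp]⟩
  obtain ⟨ω, hω, hd⟩ := phase_exists (q / p - conj (r / p))
  have hreal : conj (q / p * ω + r / p * conj ω) = q / p * ω + r / p * conj ω := by
    simp only [map_mul, map_add, map_sub, Complex.conj_conj] at hd ⊢
    linear_combination hd
  obtain ⟨k, hk⟩ := Complex.conj_eq_iff_real.1 hreal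
  have hs := Real.sq_sqrt (show 0 ≤ k ^ 2 + 4 by positivity)
  set s := Real.sqrt (k ^ 2 + 4)
  set τ : ℝ := (k + s) / 2 with hτ
  have hq : (τ : ℂ) ^ 2 = k * τ + 1 := by
    have : τ ^ 2 = k * τ + 1 := by rw [hτ]; nlinarith
    exact_mod_cast this
  have hk' : q * ω + r * conj ω = p * k := by
    rw [← hk]; field_simp
  refine ⟨τ * ω, ?_⟩
  simp only [map_mul, Complex.conj_ofReal]
  linear_combination τ * hk' - p * hq - p * (τ : ℂ) ^ 2 * hω

lemma offdiag_exists (A : M2) (hA : A.trace = 0) : ∃ Q ∈ unitary M2,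
    (star Q * A * Q) 0 0 = 0 ∧ (star Q * A * Q) 1 1 = 0 ∧
      ‖(star Q * A * Q) 1 0‖ ≤ ‖(star Q * A * Q) 0 1‖ := by
  rw [Matrix.trace_fin_two] at hA
  have h11 : A 1 1 = -A 0 0 := by linear_combination hA
  obtain ⟨y, hy⟩ := y_exists (A 0 0) (A 0 1) (A 1 0)
  set n : ℝ := Real.sqrt (1 + ‖y‖ ^ 2) with hn
  have hn2 : (n : ℂ) * n = 1 + y * conj y := by
    rw [Complex.mul_conj']
    have : n * n = 1 + ‖y‖ ^ 2 := Real.mul_self_sqrt (by positivity)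
    exact_mod_cast this
  have hn0 : (n : ℂ) ≠ 0 := by
    have : 0 < n := Real.sqrt_pos.2 (by positivity)
    exact_mod_cast this.ne'
  set Q : M2 := !![1 / n, -conj y / n; y / n, 1 / n] with hQ
  have hQu : Q ∈ unitary M2 := by
    change _ ∈ Matrix.unitaryGroup (Fin 2) ℂ
    rw [Matrix.mem_unitaryGroup_iff]
    ext i j
    fin_cases i <;> fin_cases j <;> simp [hQ, Matrix.mul_apply, Matrix.star_apply] <;> field_simp
    · linear_combination -hn2
    · ring
    · ring
    · linear_combination -hn2
  have hd0 : (star Q * A * Q) 0 0 = 0 := by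
    simp [hQ, Matrix.mul_apply, Matrix.star_apply, Fin.sum_univ_two, h11]
    field_simp
    linear_combination hy
  have hd1 : (star Q * A * Q) 1 1 = 0 := by
    simp [hQ, Matrix.mul_apply, Matrix.star_apply, Fin.sum_univ_two, h11]
    field_simp
    linear_combination -hy
  by_cases hle : ‖(star Q * A * Q) 1 0‖ ≤ ‖(star Q * A * Q) 0 1‖
  · exact ⟨Q, hQu, hd0, hd1, hle⟩
  · set P : M2 := !![0, 1; 1, 0] with hP
    have hPu : P ∈ unitary M2 := by
      change _ ∈ Matrix.unitaryGroup (Fin 2) ℂ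
      rw [Matrix.mem_unitaryGroup_iff]
      ext i j
      fin_cases i <;> fin_cases j <;> simp [hP, Matrix.mul_apply, Matrix.star_apply]
    have e : star (Q * P) * A * (Q * P) = star P * (star Q * A * Q) * P := by
      simp only [star_mul, mul_assoc]
    have e2 : ∀ X : M2, star P * X * P = !![X 1 1, X 1 0; X 0 1, X 0 0] := by
      intro X
      ext i j
      fin_cases i <;> fin_cases j <;> simp [hP, Matrix.mul_apply, Matrix.star_apply,
        Fin.sum_univ_two]
    refine ⟨Q * P, mul_mem hQu hPu, ?_, ?_, ?_⟩
    · rw [e, e2]; simpa using hd1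
    · rw [e, e2]; simpa using hd0
    · rw [e, e2]; simpa using (not_le.1 hle).le

lemma An.conj {u : ℂ → M2} (hu : An u) (P Q : M2) : An (fun z => P * u z * Q) := by
  intro z hz i j
  have h00 := hu z hz 0 0
  have h01 := hu z hz 0 1
  have h10 := hu z hz 1 0
  have h11 := hu z hz 1 1
  simp only [Matrix.mul_apply, Fin.sum_univ_two]
  fun_prop

lemma good_conj {A B Q : M2} (hQ : Q ∈ unitary M2)
    (h : Good (star Q * A * Q) (star Q * B * Q)) : Good A B := by
  obtain ⟨u, w, hu, hw, huw, hu0, hw0⟩ := h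
  have h1 := (Unitary.mem_iff.1 hQ).1
  have h2 := (Unitary.mem_iff.1 hQ).2
  refine ⟨fun z => Q * u z * star Q, fun z => Q * w z * star Q, hu.conj _ _, hw.conj _ _, ?_, ?_, ?_⟩
  · intro z hz
    obtain ⟨a, b, c⟩ := huw z hz
    refine ⟨mul_mem (mul_mem hQ a) (Unitary.star_mem hQ),
      mul_mem (mul_mem hQ b) (Unitary.star_mem hQ), ?_⟩
    have e : ∀ X Y : M2, Q * X * star Q * (Q * Y * star Q) = Q * (X * Y) * star Q := by
      intro X Y
      calc _ = Q * X * (star Q * Q) * Y * star Q := by simp only [mul_assoc]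
        _ = _ := by rw [h1]; simp only [mul_assoc, mul_one, one_mul]
    simp only [e, c, mul_neg, neg_mul]
  · simp only [hu0]
    calc _ = (Q * star Q) * A * (Q * star Q) := by simp only [mul_assoc]
      _ = A := by rw [h2, one_mul, mul_one]
  · simp only [hw0]
    calc _ = (Q * star Q) * B * (Q * star Q) := by simp only [mul_assoc]
      _ = B := by rw [h2, one_mul, mul_one]

lemma opNorm2_conj {B Q : M2} (hQ : Q ∈ unitary M2) (hB : opNorm2 B ≤ 1) :
    opNorm2 (star Q * B * Q) ≤ 1 := by
  unfold opNorm2 at *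
  have hu : ∀ X ∈ unitary M2, ‖Matrix.toEuclideanCLM (𝕜 := ℂ) X‖ ≤ 1 := by
    intro X hX
    have : Matrix.toEuclideanCLM (𝕜 := ℂ) X ∈ unitary (E2 →L[ℂ] E2) := by
      refine Unitary.mem_iff.2 ⟨?_, ?_⟩
      · rw [← map_star, ← map_mul, (Unitary.mem_iff.1 hX).1, map_one]
      · rw [← map_star, ← map_mul, (Unitary.mem_iff.1 hX).2, map_one]
    exact (CStarRing.norm_of_mem_unitary this).le
  have h1 := hu _ hQ
  have h2 := hu _ (Unitary.star_mem hQ)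
  rw [map_mul, map_mul]
  calc _ ≤ ‖Matrix.toEuclideanCLM (𝕜 := ℂ) (star Q)‖ * ‖Matrix.toEuclideanCLM (𝕜 := ℂ) B‖ *
        ‖Matrix.toEuclideanCLM (𝕜 := ℂ) Q‖ :=
        (norm_mul_le _ _).trans (mul_le_mul_of_nonneg_right (norm_mul_le _ _) (norm_nonneg _))
    _ ≤ 1 * 1 * 1 := by gcongr
    _ = 1 := by norm_num

lemma opNorm2_vec {B : M2} (hB : opNorm2 B ≤ 1) (v0 v1 : ℂ) :
    ‖B 0 0 * v0 + B 0 1 * v1‖ ^ 2 + ‖B 1 0 * v0 + B 1 1 * v1‖ ^ 2 ≤ ‖v0‖ ^ 2 + ‖v1‖ ^ 2 := by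
  have h := (Matrix.toEuclideanCLM (𝕜 := ℂ) B).le_opNorm (WithLp.toLp 2 ![v0, v1])
  have h2 : ‖Matrix.toEuclideanCLM (𝕜 := ℂ) B (WithLp.toLp 2 ![v0, v1])‖ ≤
      ‖(WithLp.toLp 2 ![v0, v1] : E2)‖ :=
    h.trans (mul_le_of_le_one_left (norm_nonneg _) hB)
  have h3 := pow_le_pow_left₀ (norm_nonneg _) h2 2
  rw [EuclideanSpace.norm_sq_eq, EuclideanSpace.norm_sq_eq] at h3
  simpa [Fin.sum_univ_two, Matrix.toEuclideanCLM_toLp, Matrix.mulVec, dotProduct] using h3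

lemma pair_good {A B : M2} (hA : opNorm2 A ≤ 1) (hB : opNorm2 B ≤ 1) (hA0 : A ≠ 0)
    (htA : A.trace = 0) (htB : B.trace = 0) (hAB : A * B = -(B * A)) : Good A B := by
  obtain ⟨Q, hQ, h00, h11, hle⟩ := offdiag_exists A htA
  apply good_conj hQ
  have h1 := (Unitary.mem_iff.1 hQ).1
  have h2 := (Unitary.mem_iff.1 hQ).2
  have hA' := opNorm2_conj hQ hA
  have hB' := opNorm2_conj hQ hB
  have htB' : (star Q * B * Q).trace = 0 := by
    rw [Matrix.trace_mul_comm, ← mul_assoc, h2, one_mul, htB]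
  have hA0' : star Q * A * Q ≠ 0 := by
    intro h
    apply hA0
    calc A = (Q * star Q) * A * (Q * star Q) := by rw [h2, one_mul, mul_one]
      _ = Q * (star Q * A * Q) * star Q := by simp only [mul_assoc]
      _ = 0 := by rw [h]; simp
  have hAB' : (star Q * A * Q) * (star Q * B * Q) = -((star Q * B * Q) * (star Q * A * Q)) := by
    have e : ∀ X Y : M2, star Q * X * Q * (star Q * Y * Q) = star Q * (X * Y) * Q := by
      intro X Y
      calc _ = star Q * X * (Q * star Q) * Y * Q := by simp only [mul_assoc]
        _ = _ := by rw [h2]; simp only [mul_assoc, mul_one]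
    rw [e, e, hAB, mul_neg, neg_mul]
  generalize star Q * A * Q = A' at *
  generalize star Q * B * Q = B' at *
  have ha : A' 0 1 ≠ 0 := by
    intro h
    apply hA0'
    rw [h, norm_zero] at hle
    have h10 : A' 1 0 = 0 := norm_le_zero_iff.1 hle
    ext i j
    fin_cases i <;> fin_cases j <;> simp [h00, h11, h, h10]
  have hb11 : B' 1 1 = -B' 0 0 := by
    rw [Matrix.trace_fin_two] at htB'
    linear_combination htB'
  have hab := congrFun (congrFun hAB' 0) 0
  simp only [Matrix.mul_apply, Fin.sum_univ_two, Matrix.neg_apply, h00] at hab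
  have hk : ‖A' 1 0 / A' 0 1‖ ≤ 1 := by
    rw [norm_div, div_le_one (norm_pos_iff.2 ha)]; exact hle
  have hr : B' 1 0 = -(A' 1 0 / A' 0 1) * B' 0 1 := by
    field_simp
    linear_combination hab
  have han : ‖A' 0 1‖ ≤ 1 := by
    have := opNorm2_vec hA' 0 1
    simp [h11] at this
    exact this
  have hg := core_good (A' 0 1) (A' 1 0 / A' 0 1) (B' 0 0) (B' 0 1) han hk (by
    intro v0 v1
    have := opNorm2_vec hB' v0 (-v1)
    rw [hr, hb11, norm_neg] at this
    refine le_trans (le_of_eq ?_) this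
    congr 3 <;> ring)
  have eA : A' = !![0, A' 0 1; A' 0 1 * (A' 1 0 / A' 0 1), 0] := by
    ext i j
    fin_cases i <;> fin_cases j <;> simp [h00, h11]
    field_simp
  have eB : B' = !![B' 0 0, B' 0 1; -(A' 1 0 / A' 0 1) * B' 0 1, -B' 0 0] := by
    ext i j
    fin_cases i <;> fin_cases j <;> simp [hb11, hr]
  rw [eA, eB]
  simpa using hg

lemma trace_zero {A B : M2} (hB : IsUnit B) (h : A * B = -(B * A)) : A.trace = 0 := by
  obtain ⟨b, rfl⟩ := hB
  have h1 : A = -((b : M2) * A * (↑b⁻¹ : M2)) := by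
    have := congrArg (· * (↑b⁻¹ : M2)) h
    simpa [mul_assoc] using this
  have h2 := congrArg Matrix.trace h1
  rw [Matrix.trace_neg, Matrix.trace_mul_comm, ← mul_assoc, Units.inv_mul, one_mul] at h2
  exact self_eq_neg.1 h2

lemma anticomm_scalar {N A : M2} (hN : N.trace = 0) (hA : A.trace = 0) :
    N * A + A * N = (N * A).trace • (1 : M2) := by
  rw [Matrix.trace_fin_two] at hN hA
  have h1 : N 1 1 = -N 0 0 := by linear_combination hN
  have h2 : A 1 1 = -A 0 0 := by linear_combination hA
  ext i j
  fin_cases i <;> fin_cases j <;>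
    simp [Matrix.mul_apply, Matrix.trace_fin_two, Fin.sum_univ_two, h1, h2] <;> ring

lemma beta_exists {T A B : M2} (hT : IsUnit T) (hA : IsUnit A) (hB : IsUnit B)
    (h12 : T * A = -(A * T)) (h13 : T * B = -(B * T)) (h23 : A * B = -(B * A)) :
    ∃ β : ℂ, β ≠ 0 ∧ T = β • (A * B) := by
  have htT := trace_zero hA h12
  have htA := trace_zero hB h23
  set M : M2 := A * B * T with hM
  have hMA : M * A = A * M := by
    rw [hM, mul_assoc, h12, mul_neg, ← mul_assoc, mul_assoc A B A, ← neg_eq_iff_eq_neg.2 h23]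
    simp only [mul_neg, neg_mul, neg_neg, mul_assoc]
  have hMB : M * B = B * M := by
    rw [hM, mul_assoc, h13, ← mul_assoc, ← mul_assoc, ← neg_eq_iff_eq_neg.2 h23]
    simp only [mul_neg, neg_mul, mul_assoc]
  set N : M2 := M - (M.trace / 2) • (1 : M2) with hN
  have htN : N.trace = 0 := by
    rw [hN, Matrix.trace_sub, Matrix.trace_smul, Matrix.trace_one]
    simp
  have hNA : N * A = A * N := by
    simp [hN, sub_mul, mul_sub, hMA]
  have hNB : N * B = B * N := by
    simp [hN, sub_mul, mul_sub, hMB]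
  have hs := anticomm_scalar htN htA
  rw [← hNA] at hs
  set c := (N * A).trace
  have hs2 : (2 : ℂ) • (N * A) = c • (1 : M2) := by rw [two_smul, hs]
  have hB0 : B ≠ 0 := hB.ne_zero
  have e : N * A * B = -(B * (N * A)) := by
    rw [mul_assoc, h23, mul_neg, ← mul_assoc, hNB, mul_assoc]
  have e2 : c • B = -(c • B) := by
    have h1 : ((2 : ℂ) • (N * A)) * B = -(B * ((2 : ℂ) • (N * A))) := by
      rw [smul_mul_assoc, e, mul_smul_comm, smul_neg]
    rw [hs2] at h1
    simpa using h1
  have hc : c = 0 := by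
    have h5 : (2 * c) • B = 0 := by
      rw [two_mul, add_smul]
      exact eq_neg_iff_add_eq_zero.1 e2
    have h6 := (smul_eq_zero.1 h5).resolve_right hB0
    simpa using h6
  have hN0 : N = 0 := by
    rw [hc, zero_smul] at hs2
    have h3 : N * A = 0 := (smul_eq_zero.1 hs2).resolve_left two_ne_zero
    exact (hA.mul_left_eq_zero).1 h3
  have hMs : M = (M.trace / 2) • (1 : M2) := sub_eq_zero.1 hN0
  have hT2 := anticomm_scalar htT htT
  set l := (T * T).trace
  have hTT : T * T = (l / 2) • (1 : M2) := by
    have : (2 : ℂ) • (T * T) = l • (1 : M2) := by rw [two_smul, hT2]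
    rw [div_eq_inv_mul, mul_smul, ← this, smul_smul]
    norm_num
  have hl : l / 2 ≠ 0 := by
    intro h
    rw [h, zero_smul] at hTT
    exact (hT.mul hT).ne_zero hTT
  have hm : M.trace / 2 ≠ 0 := by
    intro h
    rw [h, zero_smul] at hMs
    exact ((hA.mul hB).mul hT).ne_zero hMs
  have key : (l / 2) • (A * B) = (M.trace / 2) • T := by
    have h4 : M * T = (l / 2) • (A * B) := by
      rw [hM, mul_assoc (A * B), hTT, mul_smul_comm, mul_one]
    rw [← h4]
    conv_lhs => rw [hMs]
    rw [smul_mul_assoc, one_mul]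
  refine ⟨(M.trace / 2)⁻¹ * (l / 2), mul_ne_zero (inv_ne_zero hm) hl, ?_⟩
  rw [mul_smul, key, smul_smul, inv_mul_cancel₀ hm, one_smul]

/-- For an anti-commuting triple of invertible contractions `(T₁, T₂, T₃)` on `ℂ²` there exist
an anti-commuting triple of unitaries `(U₁, U₂, U₃)` and a non-zero scalar `β` such that
`(β U₁, U₂, U₃)` dilates `(T₁, T₂, T₃)`. -/
theorem stmt9 (T₁ T₂ T₃ : Matrix (Fin 2) (Fin 2) ℂ)
    (hcontr₁ : opNorm2 T₁ ≤ 1) (hcontr₂ : opNorm2 T₂ ≤ 1) (hcontr₃ : opNorm2 T₃ ≤ 1)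
    (hinv₁ : IsUnit T₁) (hinv₂ : IsUnit T₂) (hinv₃ : IsUnit T₃)
    (h₁₂ : T₁ * T₂ = -(T₂ * T₁)) (h₁₃ : T₁ * T₃ = -(T₃ * T₁)) (h₂₃ : T₂ * T₃ = -(T₃ * T₂)) :
    ∃ (K : Type) (_ : NormedAddCommGroup K) (_ : InnerProductSpace ℂ K) (_ : CompleteSpace K)
      (U₁ U₂ U₃ : K →L[ℂ] K) (β : ℂ) (V : EuclideanSpace ℂ (Fin 2) →ₗᵢ[ℂ] K),
      U₁ ∈ unitary (K →L[ℂ] K) ∧ U₂ ∈ unitary (K →L[ℂ] K) ∧ U₃ ∈ unitary (K →L[ℂ] K) ∧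
      U₁ * U₂ = -(U₂ * U₁) ∧ U₁ * U₃ = -(U₃ * U₁) ∧ U₂ * U₃ = -(U₃ * U₂) ∧
      β ≠ 0 ∧
      (∀ m n r : ℕ,
        Matrix.toEuclideanCLM (𝕜 := ℂ) (T₁ ^ m * T₂ ^ n * T₃ ^ r) =
          β ^ m • ((ContinuousLinearMap.adjoint V.toContinuousLinearMap) ∘L
            (U₁ ^ m * U₂ ^ n * U₃ ^ r) ∘L V.toContinuousLinearMap)) := by
  obtain ⟨β, hβ, hT⟩ := beta_exists hinv₁ hinv₂ hinv₃ h₁₂ h₁₃ h₂₃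
  have htA := trace_zero hinv₃ h₂₃
  have h₃₂ : T₃ * T₂ = -(T₂ * T₃) := by rw [h₂₃, neg_neg]
  have htB := trace_zero hinv₂ h₃₂
  exact good_dil β hβ hT (pair_good hcontr₂ hcontr₃ hinv₂.ne_zero htA htB h₂₃)
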